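/- Let n ≥ 1, k ≥ 1, let x_1,…,x_n ∈ ℝ^k be samples with Euclidean norm ‖x_i‖₂ ≤ l for some l > 0, let w ∈ ℝ^k with ‖w‖₂ = 1, let b ∈ ℝ, and let c1, c2 > 0 satisfy c1 ≤ 2l and c1·c2 ≥ 8·√n·l². Define R(b) = Σ_{i=1}^n f(w·x_i + b). If some sample breaks the inequality by more than c1/√3, i.e. there exists i with w·x_i + b + c1/√3 < 0, then R′(b) > 0, so the model does not converge at b. -/

import Mathlib

open scoped RealInnerProductSpace

/-- The Piecewise Biased Quadratic Unit (PBQU) activation. -/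
noncomputable def pbqu (c1 c2 : ℝ) (x : ℝ) : ℝ :=
  if x < 0 then c1 ^ 2 / (x ^ 2 + c1 ^ 2) else c2 ^ 2 / (x ^ 2 + c2 ^ 2)

/-- The derivative of the PBQU activation. -/
noncomputable def pbquDeriv (c1 c2 x : ℝ) : ℝ :=
  if x < 0 then -(2 * x * c1 ^ 2) / (x ^ 2 + c1 ^ 2) ^ 2
  else -(2 * x * c2 ^ 2) / (x ^ 2 + c2 ^ 2) ^ 2

lemma hasDerivAt_sq_div_sq_add_sq {c : ℝ} (hc : 0 < c) (x : ℝ) :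
    HasDerivAt (fun y => c ^ 2 / (y ^ 2 + c ^ 2)) (-(2 * x * c ^ 2) / (x ^ 2 + c ^ 2) ^ 2) x := by
  have h : x ^ 2 + c ^ 2 ≠ 0 := by positivity
  refine ((hasDerivAt_const x (c ^ 2)).div
    (((hasDerivAt_id' x).pow 2).add_const (c ^ 2)) h).congr_deriv ?_
  simp [mul_comm]

lemma hasDerivAt_pbqu {c1 c2 : ℝ} (hc1 : 0 < c1) (hc2 : 0 < c2) (x : ℝ) :
    HasDerivAt (pbqu c1 c2) (pbquDeriv c1 c2 x) x := by
  rcases lt_trichotomy x 0 with hx | rfl | hx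
  · rw [pbquDeriv, if_pos hx]
    refine (hasDerivAt_sq_div_sq_add_sq hc1 x).congr_of_eventuallyEq ?_
    filter_upwards [Iio_mem_nhds hx] with y hy
    exact if_pos hy
  · have hl : HasDerivWithinAt (pbqu c1 c2) 0 (Set.Iic 0) 0 := by
      have h := (hasDerivAt_sq_div_sq_add_sq hc1 0).hasDerivWithinAt (s := Set.Iic 0)
      simp only [mul_zero, zero_mul, neg_zero, zero_div] at h
      refine h.congr (fun y hy => ?_) (by simp [pbqu, hc1.ne', hc2.ne'])
      rcases (Set.mem_Iic.mp hy).lt_or_eq with hy | rfl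
      · exact if_pos hy
      · simp [pbqu, hc1.ne', hc2.ne']
    have hr : HasDerivWithinAt (pbqu c1 c2) 0 (Set.Ici 0) 0 := by
      have h := (hasDerivAt_sq_div_sq_add_sq hc2 0).hasDerivWithinAt (s := Set.Ici 0)
      simp only [mul_zero, zero_mul, neg_zero, zero_div] at h
      exact h.congr (fun y hy => if_neg (not_lt.mpr hy)) (if_neg (lt_irrefl 0))
    have h := hl.union hr
    rw [Set.Iic_union_Ici, hasDerivWithinAt_univ] at h
    simpa [pbquDeriv] using h
  · rw [pbquDeriv, if_neg hx.not_gt]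
    refine (hasDerivAt_sq_div_sq_add_sq hc2 x).congr_of_eventuallyEq ?_
    filter_upwards [Ioi_mem_nhds hx] with y hy
    exact if_neg (not_lt.mpr (le_of_lt hy))

lemma pbquDeriv_pos_of_neg {c1 c2 x : ℝ} (hc1 : 0 < c1) (hx : x < 0) :
    0 < pbquDeriv c1 c2 x := by
  rw [pbquDeriv, if_pos hx]
  have : 0 < -(2 * x * c1 ^ 2) := by
    have := mul_pos (neg_pos.mpr hx) (pow_pos hc1 2)
    linarith
  positivity

lemma pbquDeriv_nonneg_of_nonpos {c1 c2 x : ℝ} (hc1 : 0 < c1) (hx : x ≤ 0) :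
    0 ≤ pbquDeriv c1 c2 x := by
  rcases hx.lt_or_eq with hx | rfl
  · exact (pbquDeriv_pos_of_neg hc1 hx).le
  · simp [pbquDeriv]

lemma le_pbquDeriv_neg {c1 c2 l t : ℝ} (hc1 : 0 < c1) (hc1l : c1 ≤ 2 * l)
    (ht : 0 < t) (htc : c1 ^ 2 ≤ 3 * t ^ 2) (htl : t ≤ 2 * l) :
    c1 ^ 2 / (16 * l ^ 3) ≤ pbquDeriv c1 c2 (-t) := by
  have hl : 0 < l := by linarith
  rw [pbquDeriv, if_pos (neg_lt_zero.mpr ht)]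
  set L := 2 * l with hL
  have hLpos : 0 < L := by positivity
  have htL : t ^ 2 ≤ t * L := by nlinarith
  have hbr : 0 ≤ t * L * (L ^ 2 + L * t + t ^ 2) + 2 * (t * L) * c1 ^ 2 - c1 ^ 4 := by
    have h1 : c1 ^ 2 ≤ 3 * (t * L) := by linarith
    have h2 : 3 * t ^ 2 ≤ L ^ 2 + L * t + t ^ 2 := by nlinarith
    have h3 : c1 ^ 2 ≤ L ^ 2 + L * t + t ^ 2 := by linarith
    have h4 : t * L * c1 ^ 2 ≤ t * L * (L ^ 2 + L * t + t ^ 2) := by gcongr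
    have h5 : c1 ^ 2 * c1 ^ 2 ≤ 3 * (t * L) * c1 ^ 2 := by gcongr
    nlinarith
  have hmono : L * (t ^ 2 + c1 ^ 2) ^ 2 ≤ t * (L ^ 2 + c1 ^ 2) ^ 2 := by
    have := mul_nonneg (sub_nonneg.mpr htl) hbr
    linear_combination this
  have hden : t * (L ^ 2 + c1 ^ 2) ^ 2 ≤ t * (2 * L ^ 2) ^ 2 := by
    have : c1 ^ 2 ≤ L ^ 2 := by gcongr
    gcongr
    linarith
  have key : (t ^ 2 + c1 ^ 2) ^ 2 ≤ t * (4 * L ^ 3) := by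
    refine le_of_mul_le_mul_left ?_ hLpos
    calc _ ≤ _ := hmono.trans hden
      _ = _ := by ring
  rw [div_le_div_iff₀ (by positivity) (by positivity)]
  have := mul_le_mul_of_nonneg_left key (sq_nonneg c1)
  rw [hL] at this
  linear_combination this

lemma neg_le_pbquDeriv {c1 c2 l y N : ℝ} (hc1 : 0 < c1) (hc2 : 0 < c2) (hl : 0 < l) (hN : 0 < N)
    (hcc : 64 * N * l ^ 4 ≤ (c1 * c2) ^ 2) (hy : y ≤ 2 * l) :
    -(c1 ^ 2 / (16 * l ^ 3) / N) ≤ pbquDeriv c1 c2 y := by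
  rcases le_or_gt y 0 with h | h
  · exact (neg_nonpos.mpr (by positivity)).trans (pbquDeriv_nonneg_of_nonpos hc1 h)
  rw [pbquDeriv, if_neg h.not_gt, neg_div]
  refine neg_le_neg ?_
  calc 2 * y * c2 ^ 2 / (y ^ 2 + c2 ^ 2) ^ 2 ≤ 2 * (2 * l) * c2 ^ 2 / (c2 ^ 2) ^ 2 := by
        gcongr
        nlinarith
    _ = 4 * l / c2 ^ 2 := by field_simp; ring
    _ ≤ c1 ^ 2 / (16 * l ^ 3) / N := by
        rw [div_div, div_le_div_iff₀ (by positivity) (by positivity)]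
        linear_combination hcc

theorem stmt_2 (n k : ℕ) (hn : 1 ≤ n) (hk : 1 ≤ k)
    (x : Fin n → EuclideanSpace ℝ (Fin k)) (l : ℝ) (hl : 0 < l)
    (hx : ∀ i, ‖x i‖ ≤ l) (w : EuclideanSpace ℝ (Fin k)) (hw : ‖w‖ = 1)
    (b : ℝ) (c1 c2 : ℝ) (hc1 : 0 < c1) (hc2 : 0 < c2)
    (hc1l : c1 ≤ 2 * l) (hcc : 8 * Real.sqrt n * l ^ 2 ≤ c1 * c2)
    (hbreak : ∃ i, ⟪w, x i⟫ + b + c1 / Real.sqrt 3 < 0) :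
    0 < deriv (fun b' => ∑ i, pbqu c1 c2 (⟪w, x i⟫ + b')) b := by
  have hderiv : HasDerivAt (fun b' => ∑ i, pbqu c1 c2 (⟪w, x i⟫ + b'))
      (∑ i, pbquDeriv c1 c2 (⟪w, x i⟫ + b)) b :=
    HasDerivAt.fun_sum fun i _ => (hasDerivAt_pbqu hc1 hc2 _).comp_const_add _ _
  rw [hderiv.deriv]
  obtain ⟨j, hj⟩ := hbreak
  have hquot : 0 < c1 / Real.sqrt 3 := by positivity
  have hjneg : ⟪w, x j⟫ + b < 0 := by linarith
  by_cases hall : ∀ i, ⟪w, x i⟫ + b ≤ 0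
  · exact Finset.sum_pos' (fun i _ => pbquDeriv_nonneg_of_nonpos hc1 (hall i))
      ⟨j, Finset.mem_univ j, pbquDeriv_pos_of_neg hc1 hjneg⟩
  push Not at hall
  obtain ⟨m, hm⟩ := hall
  have hinner : ∀ i, |⟪w, x i⟫| ≤ l := fun i => by
    simpa [hw] using (abs_real_inner_le_norm w (x i)).trans
      (mul_le_mul_of_nonneg_left (hx i) (norm_nonneg w))
  have hjl := abs_le.mp (hinner j)
  have hml := abs_le.mp (hinner m)
  have hN : (0 : ℝ) < n := by exact_mod_cast hn
  have hcc' : 64 * (n : ℝ) * l ^ 4 ≤ (c1 * c2) ^ 2 := by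
    calc 64 * (n : ℝ) * l ^ 4 = (8 * Real.sqrt n * l ^ 2) ^ 2 := by
          rw [mul_pow, mul_pow, Real.sq_sqrt hN.le]; ring
      _ ≤ _ := by gcongr
  set M := c1 ^ 2 / (16 * l ^ 3) with hM
  have hMpos : 0 < M := by positivity
  have hjM : M ≤ pbquDeriv c1 c2 (⟪w, x j⟫ + b) := by
    have hsq : c1 ^ 2 ≤ 3 * (-(⟪w, x j⟫ + b)) ^ 2 := by
      have h : (c1 / Real.sqrt 3) ^ 2 ≤ (-(⟪w, x j⟫ + b)) ^ 2 := by
        gcongr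
        linarith
      rw [div_pow, Real.sq_sqrt (by norm_num)] at h
      linarith
    have h := le_pbquDeriv_neg (c2 := c2) hc1 hc1l (neg_pos.mpr hjneg) hsq (by linarith)
    rwa [neg_neg] at h
  have hrest : ∀ i ∈ Finset.univ.erase j, -(M / n) ≤ pbquDeriv c1 c2 (⟪w, x i⟫ + b) :=
    fun i _ => neg_le_pbquDeriv hc1 hc2 hl hN hcc' (by linarith [(abs_le.mp (hinner i)).2])
  have hsum := Finset.card_nsmul_le_sum _ _ _ hrest
  rw [Finset.card_erase_of_mem (Finset.mem_univ j), Finset.card_univ, Fintype.card_fin,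
    nsmul_eq_mul, Nat.cast_sub hn, Nat.cast_one] at hsum
  rw [← Finset.add_sum_erase _ _ (Finset.mem_univ j)]
  have hcalc : ((n : ℝ) - 1) * -(M / n) = -M + M / n := by field_simp; ring
  have : 0 < M / n := by positivity
  linarith
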